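/- Assume α > β+1, β ≥ 0, θ := γ + 2 + β − α > 0 and α − β − 1 < 4θ/(β+1). Let ρ ∈ ℝ and let u be the regular solution of L(u) + e^{u} = 0 on [0,∞) with u(0) = ρ and u'(0) = 0, and let u*(s) = ln(θ^{β+1}(α−β−1)) − θ ln s be the singular solution of the same equation. Then for every R > 0 the set { s > R : u(s) = u*(s) } is infinite, while the set { s ∈ (0,R] : u(s) = u*(s) } is finite. In particular, u − u* has infinitely many zeros on (0,∞). -/

import Mathlib

open Filter Set Real

open scoped Topology

theorem le_of_hasDerivAt_nonneg {f f' : ℝ → ℝ} {a b : ℝ} (hab : a ≤ b)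
    (hf : ∀ t ∈ Icc a b, HasDerivAt f (f' t) t) (hf' : ∀ t ∈ Icc a b, 0 ≤ f' t) :
    f a ≤ f b := by
  refine monotoneOn_of_hasDerivWithinAt_nonneg (convex_Icc a b) (f' := f')
    (fun t ht => (hf t ht).continuousAt.continuousWithinAt)
    (fun t ht => (hf t (interior_subset ht)).hasDerivWithinAt)
    (fun t ht => hf' t (interior_subset ht)) (left_mem_Icc.2 hab) (right_mem_Icc.2 hab) hab

/-- Comparison for `Z' = h - a Z` with a forcing term `h ≥ d`. -/
theorem exp_mul_sub_le_of_forcing {Z h : ℝ → ℝ} {a d T t : ℝ} (ha : 0 < a) (hTt : T ≤ t)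
    (hZ : ∀ s, T ≤ s → HasDerivAt Z (h s - a * Z s) s) (hd : ∀ s, T ≤ s → d ≤ h s) :
    exp (a * T) * (Z T - d / a) ≤ exp (a * t) * (Z t - d / a) := by
  refine le_of_hasDerivAt_nonneg (f := fun s => exp (a * s) * (Z s - d / a))
    (f' := fun s => exp (a * s) * (h s - d)) hTt (fun s hs => ?_) (fun s hs => ?_)
  · have h1 : HasDerivAt (fun s => exp (a * s)) (exp (a * s) * (a * 1)) s :=
      ((hasDerivAt_id s).const_mul a).exp
    refine (h1.mul ((hZ s hs.1).sub_const (d / a))).congr_deriv ?_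
    field_simp
    ring
  · exact mul_nonneg (exp_pos _).le (sub_nonneg.2 (hd s hs.1))

theorem eventually_lt_of_forcing {Z h : ℝ → ℝ} {a d c T : ℝ} (ha : 0 < a) (hc : c < d / a)
    (hZ : ∀ s, T ≤ s → HasDerivAt Z (h s - a * Z s) s) (hd : ∀ s, T ≤ s → d ≤ h s) :
    ∀ᶠ t in atTop, c < Z t := by
  have hlim : Tendsto (fun t => d / a + exp (-(a * t)) * (exp (a * T) * (Z T - d / a))) atTop
      (𝓝 (d / a + 0 * (exp (a * T) * (Z T - d / a)))) :=
    ((tendsto_exp_neg_atTop_nhds_zero.comp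
      (tendsto_id.const_mul_atTop ha)).mul_const _).const_add _
  rw [zero_mul, add_zero] at hlim
  filter_upwards [hlim.eventually_const_lt hc, eventually_ge_atTop T] with t ht hTt
  have h1 := exp_mul_sub_le_of_forcing ha hTt hZ hd
  have h2 : exp (-(a * t)) * (exp (a * T) * (Z T - d / a)) ≤ Z t - d / a := by
    calc _ ≤ exp (-(a * t)) * (exp (a * t) * (Z t - d / a)) := by gcongr
      _ = Z t - d / a := by rw [← mul_assoc, ← exp_add]; simp
  linarith

theorem tendsto_zero_of_forcing {Z h : ℝ → ℝ} {a : ℝ} (ha : 0 < a)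
    (hZ : ∀ s, HasDerivAt Z (h s - a * Z s) s) (hh : Tendsto h atTop (𝓝 0)) :
    Tendsto Z atTop (𝓝 0) := by
  rw [tendsto_order]
  refine ⟨fun c hc => ?_, fun c hc => ?_⟩
  · have h1 : a * (c / 2) < 0 := by nlinarith
    obtain ⟨T, hT⟩ := eventually_atTop.1 (hh.eventually_const_lt h1)
    refine eventually_lt_of_forcing (T := T) (d := a * (c / 2)) ha ?_ (fun s _ => hZ s)
      fun s hs => (hT s hs).le
    rw [mul_div_cancel_left₀ _ ha.ne']
    linarith
  · have h1 : 0 < a * (c / 2) := by positivity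
    obtain ⟨T, hT⟩ := eventually_atTop.1 (hh.eventually_lt_const h1)
    have h2 := eventually_lt_of_forcing (Z := fun s => -Z s) (h := fun s => -h s) (T := T)
      (d := -(a * (c / 2))) (c := -c) ha ?_
      (fun s _ => (hZ s).neg.congr_deriv (by ring)) fun s hs => neg_le_neg (hT s hs).le
    · filter_upwards [h2] with t ht
      linarith
    · rw [neg_div, mul_div_cancel_left₀ _ ha.ne']
      linarith

/-- A solution of `Y' = -P Z`, `Z' = Q Y - a Z` with eventually positive `Y` has `Y → 0`. -/
theorem tendsto_zero_of_pos {Y Z P Q : ℝ → ℝ} {a T : ℝ} (ha : 0 < a)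
    (hY : ∀ t, HasDerivAt Y (-(P t * Z t)) t)
    (hZ : ∀ t, HasDerivAt Z (Q t * Y t - a * Z t) t)
    (hP : ∀ t, 0 < P t) (hQ : ∀ t, 0 < Q t)
    (hPc : ∀ c, 0 < c → ∃ d, 0 < d ∧ ∀ t, c ≤ |Z t| → d ≤ P t * |Z t|)
    (hQc : ∀ c, 0 < c → ∃ d, 0 < d ∧ ∀ t, c ≤ |Y t| → d ≤ Q t * |Y t|)
    (hpos : ∀ t, T ≤ t → 0 < Y t) : Tendsto Y atTop (𝓝 0) := by
  obtain ⟨T₁, hT₁, hZT₁⟩ : ∃ T₁, T ≤ T₁ ∧ 0 ≤ Z T₁ := by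
    by_contra! hneg
    obtain ⟨d, hd, hdY⟩ := hQc (Y T) (hpos T le_rfl)
    have hmono : ∀ t, T ≤ t → Y T ≤ Y t := fun t ht =>
      le_of_hasDerivAt_nonneg ht (fun s _ => hY s) fun s hs => by
        nlinarith [hP s, hneg s hs.1]
    obtain ⟨t, ht, hTt⟩ := ((eventually_lt_of_forcing (T := T) (d := d) (c := 0) ha (by positivity)
      (fun s _ => hZ s) fun s hs => by
        have := hdY s ((hmono s hs).trans (le_abs_self _))
        rwa [abs_of_pos (hpos s hs)] at this).and (eventually_ge_atTop T)).exists
    exact lt_asymm ht (hneg t hTt)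
  have hZnn : ∀ t, T₁ ≤ t → 0 ≤ Z t := fun t ht => by
    have h1 := exp_mul_sub_le_of_forcing (d := 0) ha ht (fun s _ => hZ s)
      fun s hs => (mul_pos (hQ s) (hpos s (hT₁.trans hs))).le
    simp only [zero_div, sub_zero] at h1
    have h2 : 0 ≤ exp (a * t) * Z t := (mul_nonneg (exp_pos _).le hZT₁).trans h1
    exact nonneg_of_mul_nonneg_right h2 (exp_pos _)
  have hanti : ∀ s t, T₁ ≤ s → s ≤ t → Y t ≤ Y s := fun s t hs hst => by
    have := le_of_hasDerivAt_nonneg (f := fun t => -Y t) hst (fun r _ => (hY r).neg)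
      fun r hr => by
        rw [neg_neg]
        exact mul_nonneg (hP r).le (hZnn r (hs.trans hr.1))
    linarith
  rw [tendsto_order]
  refine ⟨fun c hc => ?_, fun c hc => ?_⟩
  · filter_upwards [eventually_ge_atTop T] with t ht using hc.trans (hpos t ht)
  suffices ∃ t, T₁ ≤ t ∧ Y t < c by
    obtain ⟨t, ht, htc⟩ := this
    filter_upwards [eventually_ge_atTop t] with s hs using (hanti t s ht hs).trans_lt htc
  by_contra! hge
  obtain ⟨d, hd, hdY⟩ := hQc c hc
  have hev := eventually_lt_of_forcing (T := T₁) (d := d) (c := d / (2 * a)) ha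
    (div_lt_div_of_pos_left hd ha (by linarith)) (fun s _ => hZ s) fun s hs => by
      have := hdY s ((hge s hs).trans (le_abs_self _))
      rwa [abs_of_pos (hpos s (hT₁.trans hs))] at this
  obtain ⟨T₂, hT₂⟩ := eventually_atTop.1 (hev.and (eventually_ge_atTop T₁))
  obtain ⟨e, he, heZ⟩ := hPc (d / (2 * a)) (by positivity)
  have hY2 : 0 < Y T₂ := hpos T₂ (hT₁.trans (hT₂ T₂ le_rfl).2)
  have hle : T₂ ≤ T₂ + Y T₂ / e := by
    have : 0 < Y T₂ / e := by positivity
    linarith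
  have h1 := le_of_hasDerivAt_nonneg (f := fun t => -Y t - e * t)
    (f' := fun t => P t * Z t - e) hle
    (fun r _ => ((hY r).neg.sub ((hasDerivAt_id r).const_mul e)).congr_deriv (by ring))
    fun r hr => by
      have h2 := heZ r ((hT₂ r hr.1).1.le.trans (le_abs_self _))
      rw [abs_of_nonneg (hZnn r (hT₂ r hr.1).2)] at h2
      linarith
  have h3 := hpos _ (hT₁.trans ((hT₂ T₂ le_rfl).2.trans hle))
  have h4 : e * (Y T₂ / e) = Y T₂ := by field_simp
  simp only [mul_add, h4] at h1
  linarith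

/-- Riccati argument: a linear system with asymptotically complex eigenvalues oscillates. -/
theorem exists_eq_zero_of_tendsto {Y Z P Q : ℝ → ℝ} {a P₀ Q₀ : ℝ} (T : ℝ)
    (hY : ∀ t, HasDerivAt Y (-(P t * Z t)) t)
    (hZ : ∀ t, HasDerivAt Z (Q t * Y t - a * Z t) t)
    (hP : Tendsto P atTop (𝓝 P₀)) (hQ : Tendsto Q atTop (𝓝 Q₀)) (hP₀ : 0 < P₀)
    (hdisc : a ^ 2 < 4 * P₀ * Q₀) : ∃ t, T ≤ t ∧ Y t = 0 := by
  by_contra! hne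
  obtain ⟨δ, ⟨hδP, hδ⟩, hδ0⟩ : ∃ δ, (δ < P₀ ∧ a ^ 2 < 4 * (P₀ - δ) * (Q₀ - δ)) ∧ 0 < δ := by
    have h1 : ∀ᶠ δ in 𝓝 (0 : ℝ), a ^ 2 < 4 * (P₀ - δ) * (Q₀ - δ) := by
      have : Continuous fun δ : ℝ => 4 * (P₀ - δ) * (Q₀ - δ) := by fun_prop
      exact this.continuousAt.eventually_const_lt (by simpa using hdisc)
    exact ((((eventually_lt_nhds hP₀).and h1).filter_mono nhdsWithin_le_nhds).and
      (self_mem_nhdsWithin (s := Ioi (0 : ℝ)))).exists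
  have hev : ∀ᶠ t in atTop, δ < P t ∧ a ^ 2 < 4 * (P t - δ) * (Q t - δ) :=
    (hP.eventually_const_lt hδP).and
      ((((hP.sub_const δ).const_mul 4).mul (hQ.sub_const δ)).eventually_const_lt hδ)
  obtain ⟨T₁, hT₁⟩ := eventually_atTop.1 (hev.and (eventually_ge_atTop T))
  have hle : T₁ ≤ T₁ + 4 / δ := by
    have : 0 < 4 / δ := by positivity
    linarith
  have h1 := le_of_hasDerivAt_nonneg (f := fun t => arctan (Z t / Y t) - δ * t)
    (f' := fun t => 1 / (1 + (Z t / Y t) ^ 2) *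
      (Q t - a * (Z t / Y t) + P t * (Z t / Y t) ^ 2) - δ) hle
    (fun t ht => by
      have hYt := hne t (hT₁ t ht.1).2
      refine ((((hZ t).div (hY t) hYt).arctan).sub
        ((hasDerivAt_id t).const_mul δ)).congr_deriv ?_
      have : 1 + (Z t / Y t) ^ 2 ≠ 0 := by positivity
      simp only [Pi.div_apply]
      rw [mul_one]
      congr 2
      field_simp
      ring)
    fun t ht => by
      obtain ⟨⟨h2, h3⟩, -⟩ := hT₁ t ht.1
      generalize Z t / Y t = p
      rw [one_div, sub_nonneg, inv_mul_eq_div, le_div_iff₀ (by positivity)]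
      have h4 : 0 < P t - δ := sub_pos.2 h2
      have h5 : 0 ≤ (P t - δ) * ((Q t - δ) - a * p + (P t - δ) * p ^ 2) := by
        nlinarith [sq_nonneg (2 * (P t - δ) * p - a)]
      have h6 := nonneg_of_mul_nonneg_right h5 h4
      linarith
  have h7 : δ * (4 / δ) = 4 := by field_simp
  simp only [mul_add, h7] at h1
  linarith [arctan_lt_pi_div_two (Z (T₁ + 4 / δ) / Y (T₁ + 4 / δ)),
    neg_pi_div_two_lt_arctan (Z T₁ / Y T₁), pi_lt_four]

/-- Backward uniqueness of the zero solution. -/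
theorem eq_zero_of_eq_zero_right {Y Z P Q : ℝ → ℝ} {a m t₀ : ℝ} (hm : m ≤ t₀)
    (hY : ∀ t, HasDerivAt Y (-(P t * Z t)) t)
    (hZ : ∀ t, HasDerivAt Z (Q t * Y t - a * Z t) t)
    (hP : Continuous P) (hQ : Continuous Q) (hY₀ : Y t₀ = 0) (hZ₀ : Z t₀ = 0) : Y m = 0 := by
  obtain ⟨A, hA⟩ := isCompact_Icc.exists_bound_of_continuousOn
    (hQ.sub hP).continuousOn (s := Icc m t₀)
  have h1 := le_of_hasDerivAt_nonneg
    (f := fun t => exp ((A + 2 * |a|) * t) * (Y t ^ 2 + Z t ^ 2))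
    (f' := fun t => exp ((A + 2 * |a|) * t) * ((A + 2 * |a|) * (Y t ^ 2 + Z t ^ 2) +
      2 * ((Q t - P t) * (Y t * Z t) - a * Z t ^ 2))) hm
    (fun t _ => by
      have h2 : HasDerivAt (fun t => exp ((A + 2 * |a|) * t))
          (exp ((A + 2 * |a|) * t) * ((A + 2 * |a|) * 1)) t :=
        ((hasDerivAt_id t).const_mul _).exp
      refine (h2.mul (((hY t).pow 2).add ((hZ t).pow 2))).congr_deriv ?_
      simp only [Pi.add_apply, Pi.pow_apply]
      push_cast
      ring)
    fun t ht => by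
      refine mul_nonneg (exp_pos _).le ?_
      obtain ⟨h3, h4⟩ := abs_le.1 (hA t ht)
      simp only [Pi.sub_apply] at h3 h4
      have h5 := le_abs_self a
      have h6 := abs_nonneg a
      nlinarith [mul_nonneg (sub_nonneg.2 h4) (sq_nonneg (Y t - Z t)),
        mul_nonneg (neg_le_iff_add_nonneg.1 h3) (sq_nonneg (Y t + Z t)),
        mul_nonneg h6 (sq_nonneg (Y t)), mul_nonneg (sub_nonneg.2 h5) (sq_nonneg (Z t))]
  rw [hY₀, hZ₀] at h1
  have h8 : Y m ^ 2 + Z m ^ 2 ≤ 0 := by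
    by_contra! h9
    have := mul_pos (exp_pos ((A + 2 * |a|) * m)) h9
    norm_num at h1
    linarith
  exact pow_eq_zero_iff two_ne_zero |>.1 (by nlinarith [sq_nonneg (Y m), sq_nonneg (Z m)])

theorem StrictMonoOn.exists_pos_le_abs_sub {f : ℝ → ℝ} {s : Set ℝ} {x₀ c : ℝ}
    (hf : StrictMonoOn f s) (hs : s ∈ 𝓝 x₀) (hc : 0 < c) :
    ∃ d, 0 < d ∧ ∀ x ∈ s, c ≤ |x - x₀| → d ≤ |f x - f x₀| := by
  obtain ⟨r, hr, hrs⟩ := Metric.nhds_basis_closedBall.mem_iff.1 hs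
  have hm : 0 < min c r := lt_min hc hr
  have hmem : ∀ x, |x - x₀| ≤ min c r → x ∈ s := fun x hx =>
    hrs (by rw [Metric.mem_closedBall, Real.dist_eq]; exact hx.trans (min_le_right _ _))
  have h0 : x₀ ∈ s := mem_of_mem_nhds hs
  have h1 : x₀ + min c r ∈ s := hmem _ (by simp [abs_of_pos hm])
  have h2 : x₀ - min c r ∈ s := hmem _ (by simp [abs_of_pos hm])
  refine ⟨min (f (x₀ + min c r) - f x₀) (f x₀ - f (x₀ - min c r)),
    lt_min (sub_pos.2 (hf h0 h1 (by linarith))) (sub_pos.2 (hf h2 h0 (by linarith))),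
    fun x hx hcx => ?_⟩
  have h3 := min_le_left c r
  rcases le_abs.1 hcx with h | h
  · refine (min_le_left _ _).trans ((sub_le_sub_right ?_ _).trans (le_abs_self _))
    exact hf.monotoneOn h1 hx (by linarith)
  · refine (min_le_right _ _).trans (le_trans ?_ (neg_le_abs _))
    have := hf.monotoneOn hx h2 (by linarith)
    linarith

theorem StrictMonoOn.dslope_pos {f : ℝ → ℝ} {s : Set ℝ} {x₀ x : ℝ}
    (hf : StrictMonoOn f s) (h0 : x₀ ∈ s) (hx : x ∈ s) (hd : 0 < deriv f x₀) :
    0 < dslope f x₀ x := by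
  rcases eq_or_ne x x₀ with rfl | hne
  · rwa [dslope_same]
  · rw [dslope_of_ne f hne, slope_def_field]
    rcases hne.lt_or_gt with h | h
    · exact div_pos_of_neg_of_neg (sub_neg.2 (hf hx h0 h)) (sub_neg.2 h)
    · exact div_pos (sub_pos.2 (hf h0 hx h)) (sub_pos.2 h)

theorem continuousAt_dslope {f : ℝ → ℝ} {x₀ x : ℝ} (h0 : DifferentiableAt ℝ f x₀)
    (hx : ContinuousAt f x) : ContinuousAt (dslope f x₀) x := by
  rcases eq_or_ne x x₀ with rfl | hne
  · exact continuousAt_dslope_same.2 h0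
  · exact (continuousAt_dslope_of_ne hne).2 hx

/-- The autonomous Emden–Fowler system `y' = θ - z^{1/b}`, `z' = a θ^b e^y - a z`: below the
critical value of `a`, the component `y` vanishes at arbitrarily large times, and a solution
through the equilibrium is stationary. -/
theorem emdenFowler_oscillation {a b θ : ℝ} {y z : ℝ → ℝ} (ha : 0 < a) (hb : 0 < b)
    (hθ : 0 < θ) (hcond : a < 4 * θ / b)
    (hy : ∀ t, HasDerivAt y (θ - z t ^ (1 / b)) t)
    (hz : ∀ t, HasDerivAt z (a * θ ^ b * exp (y t) - a * z t) t) (hpos : ∀ t, 0 < z t) :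
    (∀ T, ∃ t, T ≤ t ∧ y t = 0) ∧
      ∀ m t₀, m ≤ t₀ → y t₀ = 0 → z t₀ = θ ^ b → y m = 0 := by
  have hx0 : 0 < θ ^ b := rpow_pos_of_pos hθ b
  have hfx0 : (θ ^ b) ^ (1 / b) = θ := by
    rw [← rpow_mul hθ.le, mul_one_div_cancel hb.ne', rpow_one]
  have hfd : HasDerivAt (fun x : ℝ => x ^ (1 / b)) (1 / b * (θ ^ b) ^ (1 / b - 1)) (θ ^ b) :=
    hasDerivAt_rpow_const (Or.inl hx0.ne')
  have hdpos : 0 < 1 / b * (θ ^ b) ^ (1 / b - 1) := by positivity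
  have hmono : StrictMonoOn (fun x : ℝ => x ^ (1 / b)) (Ioi 0) :=
    (strictMonoOn_rpow_Ici_of_exponent_pos (by positivity)).mono Ioi_subset_Ici_self
  have hyc : Continuous y := continuous_iff_continuousAt.2 fun t => (hy t).continuousAt
  have hzc : Continuous z := continuous_iff_continuousAt.2 fun t => (hz t).continuousAt
  set P : ℝ → ℝ := fun t => dslope (fun x : ℝ => x ^ (1 / b)) (θ ^ b) (z t) with hPdef
  set Q : ℝ → ℝ := fun t => a * θ ^ b * dslope exp 0 (y t) with hQdef
  have hPZ : ∀ t, P t * (z t - θ ^ b) = z t ^ (1 / b) - θ := fun t => by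
    have := sub_smul_dslope (fun x : ℝ => x ^ (1 / b)) (θ ^ b) (z t)
    simp only [smul_eq_mul, hfx0] at this
    rw [← this, mul_comm]
  have hQY : ∀ t, Q t * y t = a * θ ^ b * (exp (y t) - 1) := fun t => by
    have := sub_smul_dslope exp 0 (y t)
    simp only [smul_eq_mul, exp_zero, sub_zero] at this
    rw [← this, hQdef]
    ring
  have hPpos : ∀ t, 0 < P t := fun t =>
    hmono.dslope_pos hx0 (hpos t) (by rwa [hfd.deriv])
  have hQpos : ∀ t, 0 < Q t := fun t =>
    mul_pos (by positivity) ((exp_strictMono.strictMonoOn univ).dslope_pos (mem_univ _)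
      (mem_univ _) (by simp))
  have hPx : ∀ x, 0 < x →
      ContinuousAt (dslope (fun x : ℝ => x ^ (1 / b)) (θ ^ b)) x := fun x hx =>
    continuousAt_dslope hfd.differentiableAt (continuousAt_rpow_const _ _ (Or.inl hx.ne'))
  have hQx : ∀ x, ContinuousAt (dslope exp 0) x := fun x =>
    continuousAt_dslope differentiableAt_exp continuous_exp.continuousAt
  have hPc : Continuous P := continuous_iff_continuousAt.2 fun t =>
    ContinuousAt.comp (hPx _ (hpos t)) hzc.continuousAt
  have hQc : Continuous Q := continuous_const.mul
    ((continuous_iff_continuousAt.2 hQx).comp hyc)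
  have hY : ∀ t, HasDerivAt y (-(P t * (z t - θ ^ b))) t := fun t =>
    (hy t).congr_deriv (by rw [hPZ]; ring)
  have hZ : ∀ t, HasDerivAt (fun t => z t - θ ^ b) (Q t * y t - a * (z t - θ ^ b)) t := fun t =>
    ((hz t).sub_const _).congr_deriv (by rw [hQY]; ring)
  refine ⟨fun T => ?_, fun m t₀ hm h1 h2 =>
    eq_zero_of_eq_zero_right hm hY hZ hPc hQc h1 (by simp [h2])⟩
  by_contra! hne
  have hPlow : ∀ c, 0 < c →
      ∃ d, 0 < d ∧ ∀ t, c ≤ |z t - θ ^ b| → d ≤ P t * |z t - θ ^ b| := fun c hc => by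
    obtain ⟨d, hd, h⟩ := hmono.exists_pos_le_abs_sub (Ioi_mem_nhds hx0) hc
    refine ⟨d, hd, fun t ht => (h _ (hpos t) ht).trans_eq ?_⟩
    simp only [hfx0]
    rw [← hPZ, abs_mul, abs_of_pos (hPpos t)]
  have hQlow : ∀ c, 0 < c → ∃ d, 0 < d ∧ ∀ t, c ≤ |y t| → d ≤ Q t * |y t| := fun c hc => by
    obtain ⟨d, hd, h⟩ :=
      (exp_strictMono.strictMonoOn univ).exists_pos_le_abs_sub (x₀ := 0) univ_mem hc
    refine ⟨a * θ ^ b * d, by positivity, fun t ht => ?_⟩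
    have h1 : Q t * |y t| = a * θ ^ b * |exp (y t) - exp 0| := by
      rw [← abs_of_pos (hQpos t), ← abs_mul, hQY, abs_mul, exp_zero,
        abs_of_pos (by positivity : 0 < a * θ ^ b)]
    rw [h1]
    exact mul_le_mul_of_nonneg_left (h _ (mem_univ _) (by simpa using ht)) (by positivity)
  have hylim : Tendsto y atTop (𝓝 0) := by
    have hivt : ∀ t, T ≤ t → 0 ∉ uIcc (y T) (y t) := fun t ht h0 => by
      obtain ⟨s, hs, hs0⟩ := intermediate_value_uIcc hyc.continuousOn h0
      rw [uIcc_of_le ht] at hs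
      exact hne s hs.1 hs0
    rcases (hne T le_rfl).lt_or_gt with hT | hT
    · have h1 := tendsto_zero_of_pos (Y := fun t => -y t) (Z := fun t => -(z t - θ ^ b))
        (P := P) (Q := Q) (T := T) ha (fun t => (hY t).neg.congr_deriv (by ring))
        (fun t => (hZ t).neg.congr_deriv (by ring)) hPpos hQpos
        (fun c hc => by simpa only [abs_neg] using hPlow c hc)
        (fun c hc => by simpa only [abs_neg] using hQlow c hc) fun t ht => by
          by_contra! h
          exact hivt t ht (mem_uIcc.2 (Or.inl ⟨hT.le, by linarith⟩))
      simpa using h1.neg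
    · exact tendsto_zero_of_pos ha hY hZ hPpos hQpos hPlow hQlow fun t ht => by
        by_contra! h
        exact hivt t ht (mem_uIcc.2 (Or.inr ⟨h, hT.le⟩))
  have hZlim : Tendsto (fun t => z t - θ ^ b) atTop (𝓝 0) := by
    refine tendsto_zero_of_forcing ha hZ ?_
    simp only [hQY]
    have := ((continuous_exp.tendsto 0).comp hylim).sub_const 1 |>.const_mul (a * θ ^ b)
    simpa using this
  have hzlim : Tendsto z atTop (𝓝 (θ ^ b)) := by
    simpa using hZlim.add_const (θ ^ b)
  have hPlim : Tendsto P atTop (𝓝 (1 / b * (θ ^ b) ^ (1 / b - 1))) := by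
    have := (hPx _ hx0).tendsto.comp hzlim
    rwa [dslope_same, hfd.deriv] at this
  have hQlim : Tendsto Q atTop (𝓝 (a * θ ^ b)) := by
    have := ((hQx 0).tendsto.comp hylim).const_mul (a * θ ^ b)
    simpa using this
  obtain ⟨t, ht, h0⟩ := exists_eq_zero_of_tendsto T hY hZ hPlim hQlim hdpos (by
    have h1 : 4 * (1 / b * (θ ^ b) ^ (1 / b - 1)) * (a * θ ^ b) = a * (4 * θ / b) := by
      rw [rpow_sub hx0, hfx0, rpow_one]
      field_simp
    rw [h1, sq]
    exact mul_lt_mul_of_pos_left hcond ha)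
  exact hne t ht h0

section RegularSolution

variable {γ : ℝ} {u : ℝ → ℝ}

theorem intervalIntegrable_rpow_mul_exp (hγ : -1 < γ) (hu : ContinuousOn u (Ici 0)) {t : ℝ}
    (ht : 0 ≤ t) :
    IntervalIntegrable (fun s => s ^ γ * exp (u s)) MeasureTheory.volume 0 t := by
  refine (intervalIntegral.intervalIntegrable_rpow' hγ).mul_continuousOn ?_
  rw [uIcc_of_le ht]
  exact continuous_exp.comp_continuousOn (hu.mono Icc_subset_Ici_self)

theorem integral_rpow_mul_exp_pos (hγ : -1 < γ) (hu : ContinuousOn u (Ici 0)) {t : ℝ}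
    (ht : 0 < t) : 0 < ∫ s in (0 : ℝ)..t, s ^ γ * exp (u s) :=
  intervalIntegral.intervalIntegral_pos_of_pos_on
    (intervalIntegrable_rpow_mul_exp hγ hu ht.le)
    (fun _ hs => mul_pos (rpow_pos_of_pos hs.1 _) (exp_pos _)) ht

theorem hasDerivAt_integral_rpow_mul_exp (hγ : -1 < γ) (hu : ContinuousOn u (Ici 0)) {t : ℝ}
    (ht : 0 < t) :
    HasDerivAt (fun t => ∫ s in (0 : ℝ)..t, s ^ γ * exp (u s)) (t ^ γ * exp (u t)) t := by
  have hc : ContinuousOn (fun s => s ^ γ * exp (u s)) (Ioi 0) :=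
    (continuousOn_id.rpow_const fun s hs => Or.inl (ne_of_gt hs)).mul
      (continuous_exp.comp_continuousOn (hu.mono Ioi_subset_Ici_self))
  exact intervalIntegral.integral_hasDerivAt_right
    (intervalIntegrable_rpow_mul_exp hγ hu ht.le)
    (hc.stronglyMeasurableAtFilter isOpen_Ioi t ht) (hc.continuousAt (Ioi_mem_nhds ht))

theorem exists_integral_rpow_mul_exp_le (hγ : -1 < γ) (hu : ContinuousOn u (Ici 0)) (r : ℝ) :
    ∃ C, 0 ≤ C ∧ ∀ t ∈ Ioc 0 r,
      ∫ s in (0 : ℝ)..t, s ^ γ * exp (u s) ≤ C * t ^ (γ + 1) := by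
  have hγ' : 0 < γ + 1 := by linarith
  obtain ⟨M, hM⟩ := isCompact_Icc.exists_bound_of_continuousOn
    (s := Icc 0 r) (hu.mono Icc_subset_Ici_self)
  refine ⟨exp M / (γ + 1), by positivity, fun t ht => ?_⟩
  calc ∫ s in (0 : ℝ)..t, s ^ γ * exp (u s)
      ≤ ∫ s in (0 : ℝ)..t, s ^ γ * exp M :=
        intervalIntegral.integral_mono_on ht.1.le
          (intervalIntegrable_rpow_mul_exp hγ hu ht.1.le)
          ((intervalIntegral.intervalIntegrable_rpow' hγ).mul_const _) fun s hs => by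
            have := (le_abs_self _).trans (hM s ⟨hs.1, hs.2.trans ht.2⟩)
            have := rpow_nonneg hs.1 γ
            gcongr
    _ = exp M / (γ + 1) * t ^ (γ + 1) := by
        rw [intervalIntegral.integral_mul_const, integral_rpow (Or.inl hγ),
          zero_rpow hγ'.ne']
        ring

theorem hasDerivAt_regular {α b ρ : ℝ} (hb : 0 < b) (hγ : -1 < γ) (hα : α - b < γ + 1)
    (hu : ContinuousOn u (Ici 0))
    (hueq : ∀ r, 0 ≤ r → u r = ρ - ∫ t in (0 : ℝ)..r, t ^ (-(α / b)) *
      (∫ s in (0 : ℝ)..t, s ^ γ * exp (u s)) ^ (1 / b)) {r : ℝ} (hr : 0 < r) :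
    HasDerivAt u (-(r ^ (-(α / b)) *
      (∫ s in (0 : ℝ)..r, s ^ γ * exp (u s)) ^ (1 / b))) r := by
  set F : ℝ → ℝ := fun t => ∫ s in (0 : ℝ)..t, s ^ γ * exp (u s) with hF
  have hFpos : ∀ t, 0 < t → 0 < F t := fun t ht => integral_rpow_mul_exp_pos hγ hu ht
  have hc : ContinuousOn (fun t => t ^ (-(α / b)) * F t ^ (1 / b)) (Ioi 0) :=
    (continuousOn_id.rpow_const fun s hs => Or.inl (ne_of_gt hs)).mul
      (ContinuousOn.rpow_const (fun t ht =>
        (hasDerivAt_integral_rpow_mul_exp hγ hu ht).continuousAt.continuousWithinAt)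
        fun s hs => Or.inl (hFpos s hs).ne')
  obtain ⟨C, hC, hFC⟩ := exists_integral_rpow_mul_exp_le hγ hu r
  have hint : IntervalIntegrable (fun t => t ^ (-(α / b)) * F t ^ (1 / b))
      MeasureTheory.volume 0 r := by
    have hexp : -1 < (γ + 1 - α) / b := by
      rw [lt_div_iff₀ hb]
      linarith
    refine ((intervalIntegral.intervalIntegrable_rpow' (a := 0) (b := r) hexp).const_mul
      (C ^ (1 / b))).mono_fun' ?_ ?_
    · rw [uIoc_of_le hr.le]
      exact (hc.mono Ioc_subset_Ioi_self).aestronglyMeasurable measurableSet_Ioc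
    · rw [uIoc_of_le hr.le]
      refine MeasureTheory.ae_restrict_of_forall_mem measurableSet_Ioc fun t ht => ?_
      have ht0 : 0 < t := ht.1
      have hFt := hFpos t ht0
      beta_reduce
      rw [norm_of_nonneg (by positivity)]
      calc t ^ (-(α / b)) * F t ^ (1 / b)
          ≤ t ^ (-(α / b)) * (C * t ^ (γ + 1)) ^ (1 / b) := by
            gcongr
            exact hFC t ht
        _ = C ^ (1 / b) * t ^ ((γ + 1 - α) / b) := by
            rw [mul_rpow hC (by positivity), ← rpow_mul ht0.le, mul_left_comm,
              ← rpow_add ht0]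
            congr 2
            ring
  have h1 := (intervalIntegral.integral_hasDerivAt_right hint
    (hc.stronglyMeasurableAtFilter isOpen_Ioi r hr)
    (hc.continuousAt (Ioi_mem_nhds hr))).const_sub ρ
  refine h1.congr_of_eventuallyEq ?_
  filter_upwards [Ioi_mem_nhds hr] with t ht using hueq t (le_of_lt ht)

end RegularSolution

/-- Theorem 1.5 / 5.1: for `L(u) + e^u = 0` with `2k < d < 2k+8`
(i.e. `0 < α − β − 1 < 4θ/(β+1)`), the regular solution `u` (with `u(0) = ρ`,
`u'(0) = 0`, given by its integral equation) intersects the singular solution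
`u*(s) = ln(θ^{β+1}(α−β−1)) − θ ln s` infinitely many times on `(R, ∞)` for every
`R > 0`, while only finitely many times on `(0, R]`; in particular `u − u*` has
infinitely many zeros on `(0, ∞)`. -/
theorem stmt_5 (α β γ θ : ℝ) (hθ : θ = γ + 2 + β - α)
    (hαβ : α > β + 1) (hβ : 0 ≤ β) (hθpos : 0 < θ)
    (hcond : α - β - 1 < 4 * θ / (β + 1))
    (ρ : ℝ) (u : ℝ → ℝ) (hu : ContinuousOn u (Ici 0))
    (hueq : ∀ r, 0 ≤ r →
      u r = ρ - ∫ t in (0:ℝ)..r, t ^ (-(α / (β + 1))) *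
        (∫ s in (0:ℝ)..t, s ^ γ * Real.exp (u s)) ^ ((1:ℝ) / (β + 1)))
    (ustar : ℝ → ℝ)
    (hustar : ∀ s, ustar s = Real.log (θ ^ (β + 1) * (α - β - 1)) - θ * Real.log s) :
    (∀ R, 0 < R →
      {s : ℝ | R < s ∧ u s = ustar s}.Infinite ∧
      {s : ℝ | s ∈ Ioc 0 R ∧ u s = ustar s}.Finite) ∧
    {s : ℝ | 0 < s ∧ u s = ustar s}.Infinite := by
  have hb : 0 < β + 1 := by linarith
  have ha : 0 < α - β - 1 := by linarith
  have hγ : -1 < γ := by linarith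
  have hC : 0 < θ ^ (β + 1) * (α - β - 1) := by positivity
  set F : ℝ → ℝ := fun t => ∫ s in (0 : ℝ)..t, s ^ γ * exp (u s) with hF
  have hFpos : ∀ t, 0 < t → 0 < F t := fun t ht => integral_rpow_mul_exp_pos hγ hu ht
  have hFd : ∀ t, 0 < t → HasDerivAt F (t ^ γ * exp (u t)) t := fun t ht =>
    hasDerivAt_integral_rpow_mul_exp hγ hu ht
  have hud : ∀ r, 0 < r → HasDerivAt u (-(r ^ (-(α / (β + 1))) * F r ^ (1 / (β + 1)))) r :=
    fun r hr => hasDerivAt_regular hb hγ (by linarith) hu hueq hr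
  set y : ℝ → ℝ := fun t => u (exp t) - ustar (exp t) with hy
  set z : ℝ → ℝ := fun t => exp (-((α - β - 1) * t)) * F (exp t) with hz
  have hzpos : ∀ t, 0 < z t := fun t => mul_pos (exp_pos _) (hFpos _ (exp_pos t))
  have hzpow : ∀ t, z t ^ (1 / (β + 1)) =
      exp t ^ (-(α / (β + 1))) * F (exp t) ^ (1 / (β + 1)) * exp t := fun t => by
    rw [hz, mul_rpow (exp_pos _).le (hFpos _ (exp_pos t)).le, mul_right_comm, ← exp_mul,
      ← exp_mul, ← exp_add]
    congr 2
    field_simp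
    ring
  have hyd : ∀ t, HasDerivAt y (θ - z t ^ (1 / (β + 1))) t := fun t => by
    have h1 := (hud _ (exp_pos t)).comp t (hasDerivAt_exp t)
    have h2 : HasDerivAt (fun t => log (θ ^ (β + 1) * (α - β - 1)) - θ * t) (-(θ * 1)) t :=
      ((hasDerivAt_id t).const_mul θ).const_sub _
    have h3 := h1.sub h2
    have h4 : y = u ∘ exp - fun t => log (θ ^ (β + 1) * (α - β - 1)) - θ * t := by
      ext s
      simp [hy, hustar]
    rw [h4]
    exact h3.congr_deriv (by rw [hzpow]; ring)
  have hexpy : ∀ t, (α - β - 1) * θ ^ (β + 1) * exp (y t) = exp (u (exp t)) * exp (θ * t) :=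
    fun t => by
      simp only [hy, hustar, log_exp]
      rw [← sub_add, exp_add, exp_sub, exp_log hC]
      field_simp
  have hzd : ∀ t, HasDerivAt z
      ((α - β - 1) * θ ^ (β + 1) * exp (y t) - (α - β - 1) * z t) t := fun t => by
    have h1 : HasDerivAt (fun t => exp (-((α - β - 1) * t)))
        (exp (-((α - β - 1) * t)) * -((α - β - 1) * 1)) t :=
      ((hasDerivAt_id t).const_mul (α - β - 1)).neg.exp
    refine (h1.mul ((hFd _ (exp_pos t)).comp t (hasDerivAt_exp t))).congr_deriv ?_
    have h2 : exp (θ * t) = exp (-((α - β - 1) * t)) * (exp t ^ γ * exp t) := by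
      rw [← exp_mul, ← exp_add, ← exp_add]
      congr 1
      rw [hθ]
      ring
    rw [hexpy, h2]
    simp only [hz, Function.comp_apply]
    ring
  obtain ⟨hosc, huniq⟩ := emdenFowler_oscillation ha hb hθpos hcond hyd hzd hzpos
  have hinf : ∀ R, 0 < R → {s : ℝ | R < s ∧ u s = ustar s}.Infinite := fun R hR => by
    refine infinite_of_forall_exists_gt fun c => ?_
    have hm : 0 < max R c := lt_max_of_lt_left hR
    obtain ⟨t, ht, h0⟩ := hosc (log (max R c) + 1)
    have h1 : max R c < exp t := (log_lt_iff_lt_exp hm).1 (by linarith)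
    exact ⟨exp t, ⟨(le_max_left _ _).trans_lt h1, sub_eq_zero.1 h0⟩,
      (le_max_right _ _).trans_lt h1⟩
  refine ⟨fun R hR => ⟨hinf R hR, ?_⟩, (hinf 1 one_pos).mono fun s hs =>
    ⟨one_pos.trans hs.1, hs.2⟩⟩
  obtain ⟨r, hr, hne⟩ : ∃ r, 0 < r ∧ ∀ s ∈ Ioo 0 r, u s ≠ ustar s := by
    have hu0 : Tendsto u (𝓝[>] 0) (𝓝 (u 0)) :=
      ((hu 0 self_mem_Ici).mono Ioi_subset_Ici_self).tendsto
    have h1 : Tendsto (fun s => u s + θ * log s) (𝓝[>] 0) atBot :=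
      hu0.add_atBot (tendsto_log_nhdsGT_zero.const_mul_atBot hθpos)
    obtain ⟨r, hr, hrs⟩ := mem_nhdsGT_iff_exists_Ioo_subset.1
      (h1.eventually_lt_atBot (log (θ ^ (β + 1) * (α - β - 1))))
    refine ⟨r, hr, fun s hs h => ?_⟩
    have h2 : u s + θ * log s < log (θ ^ (β + 1) * (α - β - 1)) := hrs hs
    rw [h, hustar] at h2
    linarith
  by_contra hfin
  obtain ⟨s₀, hs₀, hacc⟩ := Set.Infinite.exists_accPt_of_subset_isCompact (K := Icc r R) hfin
    isCompact_Icc fun s hs => ⟨by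
      by_contra! h
      exact hne s ⟨hs.1.1, h⟩ hs.2, hs.1.2⟩
  have hs₀pos : 0 < s₀ := hr.trans_le hs₀.1
  have hyacc : ∃ᶠ t in 𝓝[≠] (log s₀), y t = 0 := by
    rw [accPt_iff_frequently_nhdsNE] at hacc
    have hlog : Tendsto log (𝓝[≠] s₀) (𝓝[≠] (log s₀)) :=
      (hasDerivAt_log hs₀pos.ne').tendsto_nhdsNE (inv_ne_zero hs₀pos.ne')
    refine hlog.frequently (hacc.mono fun s hs => ?_)
    simp only [hy, exp_log hs.1.1, hs.2, sub_self]
  have hy0 : y (log s₀) = 0 := by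
    by_contra h
    exact hyacc (((hyd _).continuousAt.eventually_ne h).filter_mono nhdsWithin_le_nhds)
  have hz0 : z (log s₀) = θ ^ (β + 1) := by
    have h1 : θ - z (log s₀) ^ (1 / (β + 1)) = 0 := by
      by_contra h
      exact hyacc ((hyd _).eventually_ne h)
    rw [sub_eq_zero.1 h1, ← rpow_mul (hzpos _).le, one_div_mul_cancel hb.ne', rpow_one]
  have h1 := huniq (log (r / 2)) (log s₀)
    (log_le_log (by positivity) (by linarith [hs₀.1])) hy0 hz0
  simp only [hy, exp_log (half_pos hr)] at h1
  exact hne (r / 2) ⟨half_pos hr, half_lt_self hr⟩ (sub_eq_zero.1 h1)
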